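/- arXiv:1704.07405 — 3 statements merged into one kernel-verified Lean document; each statement's English description precedes it below -/
import Mathlib

section
/- Let α ∈ [0,1], d_max > 0, w_max > 0, and let w be a nonnegative weight function on a keyword type. Let q = (q.λ, q.ψ) be a query with q.λ ∈ ℝ² and q.ψ a nonempty finite keyword set. Let N = (Λ_N, Ψ_N) and N_c = (Λ_c, Ψ_c) be such that Λ_c and Λ_N are subsets of ℝ² with ∅ ≠ Λ_c ⊆ Λ_N, and Ψ_c ⊆ Ψ_N are finite keyword sets. Then cost(q, N) ≤ cost(q, N_c), i.e. α·infDist(q.λ, Λ_N)/d_max + (1−α)·(1 − similarity_key(q.ψ, Ψ_N)) ≤ α·infDist(q.λ, Λ_c)/d_max + (1−α)·(1 − similarity_key(q.ψ, Ψ_c)). -/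
/-- Normalized keyword-set similarity:
`similarity_key(qψ, Ψ) = (1/|qψ|) · Σ_{y ∈ qψ ∩ Ψ} w(y)/w_max`. -/
noncomputable def simKey {κ : Type*} [DecidableEq κ]
    (qψ Ψ : Finset κ) (w : κ → ℝ) (wmax : ℝ) : ℝ :=
  (1 / (qψ.card : ℝ)) * ∑ y ∈ qψ ∩ Ψ, w y / wmax

theorem simKey_mono {κ : Type*} [DecidableEq κ] (qψ : Finset κ) {Ψ₁ Ψ₂ : Finset κ}
    {w : κ → ℝ} {wmax : ℝ} (hw : ∀ y, 0 ≤ w y) (hwmax : 0 ≤ wmax) (h : Ψ₁ ⊆ Ψ₂) :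
    simKey qψ Ψ₁ w wmax ≤ simKey qψ Ψ₂ w wmax :=
  mul_le_mul_of_nonneg_left
    (Finset.sum_le_sum_of_subset_of_nonneg (Finset.inter_subset_inter_left h)
      fun y _ _ => div_nonneg (hw y) hwmax)
    (by positivity)

/-- Lemma 1 of the paper: the cost of an IR-tree node lower bounds the cost
of any of its children. -/
theorem node_cost_le_child_cost
    {κ : Type*} [DecidableEq κ]
    (α dmax wmax : ℝ) (hα0 : 0 ≤ α) (hα1 : α ≤ 1)
    (hd : 0 < dmax) (hwmax : 0 < wmax)
    (w : κ → ℝ) (hw : ∀ y, 0 ≤ w y)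
    (qloc : EuclideanSpace ℝ (Fin 2)) (qψ : Finset κ) (hqψ : qψ.Nonempty)
    (ΛN Λc : Set (EuclideanSpace ℝ (Fin 2)))
    (hΛc : Λc.Nonempty) (hΛ : Λc ⊆ ΛN)
    (ΨN Ψc : Finset κ) (hΨ : Ψc ⊆ ΨN) :
    α * Metric.infDist qloc ΛN / dmax + (1 - α) * (1 - simKey qψ ΨN w wmax) ≤
      α * Metric.infDist qloc Λc / dmax + (1 - α) * (1 - simKey qψ Ψc w wmax) := by
  have hdist := Metric.infDist_le_infDist_of_subset (x := qloc) hΛ hΛc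
  have hsim := simKey_mono qψ hw hwmax.le hΨ
  have hα : 0 ≤ 1 - α := sub_nonneg.2 hα1
  gcongr
end

section
/- Let ι be a type, Q a finite subset of ι, c_N, c_o : ι → ℝ with 0 ≤ c_N q ≤ c_o q for all q ∈ Q, let m ≤ |Q|, and let t ∈ ℝ. Suppose that every subset S ⊆ Q with |S| = m satisfies Σ_{q ∈ S} c_N q ≥ t. Then for every i with m ≤ i ≤ |Q| and every subset S ⊆ Q with |S| = i, Σ_{q ∈ S} c_o q ≥ t. -/
/-- Correctness of the relaxed MFSNNK pruning rule (Heuristic 4) for the SUM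
aggregate with nonnegative costs: if every size-`m` subgroup of `Q` has node
cost at least `t`, then for every `i` with `m ≤ i ≤ |Q|`, every size-`i`
subgroup has object cost at least `t`. -/
theorem mfsnnk_relaxed_prune_sum
    {ι : Type*} (Q : Finset ι) (cN cO : ι → ℝ)
    (hc : ∀ q ∈ Q, 0 ≤ cN q ∧ cN q ≤ cO q)
    (m : ℕ) (hm : m ≤ Q.card) (t : ℝ)
    (hN : ∀ S ⊆ Q, S.card = m → t ≤ ∑ q ∈ S, cN q) :
    ∀ i, m ≤ i → i ≤ Q.card → ∀ S ⊆ Q, S.card = i → t ≤ ∑ q ∈ S, cO q := by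
  intro i hmi _ S hSQ hS
  obtain ⟨T, hTS, hT⟩ := Finset.exists_subset_card_eq (hmi.trans_eq hS.symm)
  calc t ≤ ∑ q ∈ T, cN q := hN T (hTS.trans hSQ) hT
    _ ≤ ∑ q ∈ S, cN q :=
      Finset.sum_le_sum_of_subset_of_nonneg hTS fun q hq _ => (hc q (hSQ hq)).1
    _ ≤ ∑ q ∈ S, cO q := Finset.sum_le_sum fun q hq => (hc q (hSQ hq)).2
end

section
/- Let ι be a type, Q a finite subset of ι, c_N, c_o : ι → ℝ with c_N q ≤ c_o q for all q ∈ Q, let 1 ≤ m ≤ |Q|, and let t ∈ ℝ. Suppose that every subset S ⊆ Q with |S| = m satisfies max_{q ∈ S} c_N q ≥ t. Then for every i with m ≤ i ≤ |Q| and every subset S ⊆ Q with |S| = i, max_{q ∈ S} c_o q ≥ t. -/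
/-- Correctness of the relaxed MFSNNK pruning rule (Heuristic 4) for the MAX
aggregate: if every size-`m` subgroup of `Q` has node cost at least `t`, then
for every `i` with `m ≤ i ≤ |Q|`, every size-`i` subgroup has object cost at
least `t`. -/
theorem mfsnnk_relaxed_prune_max
    {ι : Type*} (Q : Finset ι) (cN cO : ι → ℝ)
    (hc : ∀ q ∈ Q, cN q ≤ cO q)
    (m : ℕ) (hm1 : 1 ≤ m) (hm : m ≤ Q.card) (t : ℝ)
    (hN : ∀ S ⊆ Q, ∀ hS : S.card = m,
      t ≤ S.sup' (by rw [← Finset.card_pos, hS]; omega) cN) :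
    ∀ i, ∀ hmi : m ≤ i, i ≤ Q.card → ∀ S ⊆ Q, ∀ hS : S.card = i,
      t ≤ S.sup' (by rw [← Finset.card_pos, hS]; omega) cO := by
  intro i hmi _ S hSQ hS
  obtain ⟨T, hTS, hT⟩ := Finset.exists_subset_card_eq (hS ▸ hmi : m ≤ S.card)
  refine (hN T (hTS.trans hSQ) hT).trans (Finset.sup'_le _ _ fun q hq => ?_)
  exact (hc q (hSQ (hTS hq))).trans (Finset.le_sup' cO (hTS hq))
end
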